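/- Let G be a finite group and g a natural number. Then, as an identity of real numbers, the number of 2g-tuples (a₁, b₁, …, a_g, b_g) ∈ G^{2g} satisfying ∏_{i=1}^{g} aᵢ bᵢ aᵢ⁻¹ bᵢ⁻¹ = 1 equals |G|^{2g−1} · Σ_{V ∈ Irr(G)} (dim V)^{2−2g}, where the sum runs over a complete set Irr(G) of pairwise non-isomorphic irreducible complex representations of G and the exponents are integer powers (so |G|^{−1} appears when g = 0). Equivalently (Mednykh's formula), #Hom(π₁(Σ), G) · |G|^{E(Σ)−1} = Σ_{V ∈ Irr(G)} (dim V)^{E(Σ)} for the closed orientable surface Σ of genus g, whose Euler characteristic is E(Σ) = 2 − 2g and whose fundamental group has homomorphisms to G counted by the tuple count above. -/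

import Mathlib

open scoped MonoidAlgebra

theorem sum_prod_ofFn_comp {R α : Type*} [Semiring R] [Fintype α] (f : α → R) (n : ℕ) :
    ∑ t : Fin n → α, (List.ofFn fun i => f (t i)).prod = (∑ a, f a) ^ n := by
  induction n with
  | zero => simp
  | succ n ih =>
    rw [← (Fin.consEquiv fun _ => α).sum_comp, Fintype.sum_prod_type, pow_succ', ← ih,
      Finset.sum_mul_sum]
    simp [List.ofFn_succ, Fin.consEquiv]

namespace Representation

section Schur

variable {G k V : Type*} [Group G] [Field k] [IsAlgClosed k] [CharZero k]
  [AddCommGroup V] [Module k V] [FiniteDimensional k V]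
  (ρ : Representation k G V) [IsIrreducible ρ]

omit [IsAlgClosed k] in
include ρ in
theorem IsIrreducible.finrank_ne_zero : (Module.finrank k V : k) ≠ 0 := by
  have := IsSimpleModule.nontrivial k[G] ρ.asModule
  have : Nontrivial V := ρ.asModuleEquiv.symm.toEquiv.nontrivial
  exact_mod_cast Module.finrank_pos.ne'

theorem IsIrreducible.eq_trace_div_finrank_smul_one (f : Module.End k V)
    (hf : ∀ x, Commute f (ρ x)) :
    f = (LinearMap.trace k V f / Module.finrank k V) • (1 : Module.End k V) := by
  obtain ⟨c, hc⟩ := (IsIrreducible.algebraMap_intertwiningMap_bijective_of_isAlgClosed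
    (ρ := ρ)).2 ⟨f, fun x => (hf x).eq⟩
  have hfc : f = c • (1 : Module.End k V) := (congrArg IntertwiningMap.toLinearMap hc).symm
  have hd := IsIrreducible.finrank_ne_zero ρ
  rw [hfc]
  simp [hd]

variable [Fintype G]

theorem IsIrreducible.sum_conj (f : Module.End k V) :
    ∑ x, ρ x * f * ρ x⁻¹ =
      ((Nat.card G : k) * LinearMap.trace k V f / Module.finrank k V) •
        (1 : Module.End k V) := by
  rw [IsIrreducible.eq_trace_div_finrank_smul_one ρ (∑ x, ρ x * f * ρ x⁻¹)]
  · congr 2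
    rw [map_sum, Finset.sum_congr rfl fun x _ => ?_, Finset.sum_const, Finset.card_univ,
      nsmul_eq_mul, Nat.card_eq_fintype_card]
    rw [LinearMap.trace_mul_comm, ← mul_assoc, ← map_mul, inv_mul_cancel, map_one, one_mul]
  · intro y
    rw [commute_iff_eq, Finset.sum_mul, Finset.mul_sum,
      ← Fintype.sum_equiv (Equiv.mulLeft y) _ _ fun x => rfl]
    refine Finset.sum_congr rfl fun x _ => ?_
    simp only [Equiv.coe_mulLeft, mul_inv_rev, map_mul, mul_assoc]
    rw [← map_mul ρ y⁻¹ y, inv_mul_cancel, map_one, mul_one]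

theorem IsIrreducible.sum_character_mul_character_inv :
    ∑ x, ρ.character x * ρ.character x⁻¹ = (Nat.card G : k) := by
  have hG : (Nat.card G : k) ≠ 0 := by exact_mod_cast Nat.card_pos.ne'
  let := invertibleOfNonzero hG
  have h := char_orthonormal ρ ρ
  rw [if_pos ⟨Equiv.refl ρ⟩, inv_mul_eq_iff_eq_mul₀ hG] at h
  simpa using h

theorem IsIrreducible.sum_character_mul_character_inv_of_isEmpty {W : Type*} [AddCommGroup W]
    [Module k W] [FiniteDimensional k W] (σ : Representation k G W) [IsIrreducible σ]
    (h : IsEmpty (Equiv σ ρ)) :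
    ∑ x, ρ.character x * σ.character x⁻¹ = 0 := by
  have hG : (Nat.card G : k) ≠ 0 := by exact_mod_cast Nat.card_pos.ne'
  let := invertibleOfNonzero hG
  have h' := char_orthonormal ρ σ
  rw [if_neg (not_nonempty_iff.mpr h)] at h'
  simpa [hG] using h'

/-- A class function acts on an irreducible representation by a scalar. -/
theorem IsIrreducible.sum_smul_of_conj (f : G → k) (hf : ∀ x y, f (y * x * y⁻¹) = f x) :
    ∑ x, f x • ρ x = ((∑ x, f x * ρ.character x) / Module.finrank k V) •
      (1 : Module.End k V) := by
  rw [IsIrreducible.eq_trace_div_finrank_smul_one ρ (∑ x, f x • ρ x)]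
  · simp [character]
  · intro y
    rw [commute_iff_eq, Finset.sum_mul, Finset.mul_sum, ← (MulAut.conj y).toEquiv.sum_comp]
    refine Finset.sum_congr rfl fun x _ => ?_
    simp [hf, ← map_mul]

theorem IsIrreducible.sum_commutator :
    ∑ p : G × G, ρ (p.1 * p.2 * p.1⁻¹ * p.2⁻¹) =
      ((Nat.card G : k) / Module.finrank k V) ^ 2 • (1 : Module.End k V) := by
  have hd := IsIrreducible.finrank_ne_zero ρ
  have h (b : G) : ∑ a, ρ (a * b * a⁻¹ * b⁻¹) =
      ((Nat.card G : k) / Module.finrank k V) • ρ.character b • ρ b⁻¹ := by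
    simp only [map_mul]
    rw [← Finset.sum_mul, IsIrreducible.sum_conj, smul_mul_assoc, one_mul, smul_smul, character]
    congr 1
    ring
  rw [Fintype.sum_prod_type_right, Finset.sum_congr rfl fun b _ => h b, ← Finset.smul_sum,
    ← Fintype.sum_equiv (Equiv.inv G) _ _ fun x => rfl]
  simp only [Equiv.inv_apply, inv_inv]
  rw [IsIrreducible.sum_smul_of_conj ρ (fun x => ρ.character x⁻¹), smul_smul]
  · congr 1
    simp_rw [mul_comm (ρ.character _⁻¹)]
    rw [IsIrreducible.sum_character_mul_character_inv]
    ring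
  · intro x y
    rw [← char_conj ρ x⁻¹ y]
    simp [mul_assoc]

theorem IsIrreducible.sum_character_prod_commutator (g : ℕ) :
    ∑ t : Fin g → G × G, ρ.character
        (List.ofFn fun i => (t i).1 * (t i).2 * (t i).1⁻¹ * (t i).2⁻¹).prod =
      ((Nat.card G : k) / Module.finrank k V) ^ (2 * g) * Module.finrank k V := by
  have h := congrArg (LinearMap.trace k V)
    (sum_prod_ofFn_comp (fun p : G × G => ρ (p.1 * p.2 * p.1⁻¹ * p.2⁻¹)) g)
  rw [IsIrreducible.sum_commutator, smul_pow, one_pow, ← pow_mul, map_smul,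
    LinearMap.trace_one, smul_eq_mul, map_sum] at h
  rw [← h]
  refine Finset.sum_congr rfl fun t _ => ?_
  rw [character, map_list_prod, List.map_ofFn]
  rfl

end Schur

section OfModule

variable {G k : Type*} [Monoid G] [CommSemiring k] (M : Type*) [AddCommMonoid M] [Module k M]
  [Module k[G] M] [IsScalarTower k k[G] M]

theorem asAlgebraHom_ofModule'_apply (r : k[G]) (m : M) :
    (ofModule' (k := k) (G := G) M).asAlgebraHom r m = r • m := by
  exact DFunLike.congr_fun (DFunLike.congr_fun
    ((MonoidAlgebra.lift k (Module.End k M) G).apply_symm_apply (Algebra.lsmul k k M)) r) m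

/-- The module associated with the representation `ofModule' M` is `M`. -/
noncomputable def asModuleOfModule'Equiv :
    (ofModule' (k := k) (G := G) M).asModule ≃ₗ[k[G]] M where
  toAddEquiv := (asModuleEquiv _).toAddEquiv
  map_smul' r m := asAlgebraHom_ofModule'_apply M r m

end OfModule

section Regular

variable {G k : Type} [Group G] [Fintype G] [Field k] [IsAlgClosed k] [CharZero k]

omit [IsAlgClosed k] in
/-- An element of the group algebra which acts as the identity on every irreducible
representation is `1`. -/
theorem eq_one_of_asAlgebraHom_eq_one (e : k[G])
    (h : ∀ (W : Type) [AddCommGroup W] [Module k W] [FiniteDimensional k W]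
      (σ : Representation k G W), IsIrreducible σ → σ.asAlgebraHom e = 1) : e = 1 := by
  have : NeZero (Nat.card G : k) := ⟨by exact_mod_cast Nat.card_pos.ne'⟩
  have hsimple (S : Submodule k[G] k[G]) [IsSimpleModule k[G] S] (x : S) : e • x = x := by
    have hirr : IsIrreducible (ofModule' (k := k) (G := G) S) :=
      (irreducible_iff_isSimpleModule_asModule _).mpr (.congr (asModuleOfModule'Equiv S))
    have : FiniteDimensional k S := Module.Finite.trans k[G] S
    rw [← asAlgebraHom_ofModule'_apply, h _ _ hirr, Module.End.one_apply]
  have htop (x : k[G]) : e * x = x := by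
    have hx : x ∈ sSup {m : Submodule k[G] k[G] | IsSimpleModule k[G] m} := by
      rw [IsSemisimpleModule.sSup_simples_eq_top]
      trivial
    rw [sSup_eq_iSup'] at hx
    induction hx using Submodule.iSup_induction' with
    | mem S y hy =>
      have : IsSimpleModule k[G] S.1 := S.2
      exact congrArg Subtype.val (hsimple S.1 ⟨y, hy⟩)
    | zero => simp
    | add y z _ _ hy hz => rw [mul_add, hy, hz]
  simpa using htop 1

/-- The decomposition of the character of the regular representation. -/
theorem sum_finrank_mul_character {ι : Type*} [Fintype ι] {W : ι → Type}
    [∀ i, AddCommGroup (W i)] [∀ i, Module k (W i)] [∀ i, FiniteDimensional k (W i)]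
    (ρ : ∀ i, Representation k G (W i)) [∀ i, IsIrreducible (ρ i)]
    (hdisj : ∀ i j, i ≠ j → IsEmpty (Equiv (ρ i) (ρ j)))
    (hcomplete : ∀ (W' : Type) [AddCommGroup W'] [Module k W'] [FiniteDimensional k W']
      (σ : Representation k G W'), IsIrreducible σ → ∃ i, Nonempty (Equiv σ (ρ i)))
    [DecidableEq G] (x : G) :
    ∑ i, (Module.finrank k (W i) : k) * (ρ i).character x =
      if x = 1 then (Nat.card G : k) else 0 := by
  have hG : (Nat.card G : k) ≠ 0 := by exact_mod_cast Nat.card_pos.ne'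
  let c (y : G) : k := ∑ i, (Module.finrank k (W i) : k) * (ρ i).character y⁻¹
  let e : k[G] := (Nat.card G : k)⁻¹ • ∑ y, MonoidAlgebra.single y (c y)
  have hc (y z : G) : c (z * y * z⁻¹) = c y := by
    refine Finset.sum_congr rfl fun i _ => ?_
    rw [← char_conj (ρ i) y⁻¹ z]
    simp [mul_assoc]
  have hact (j : ι) : (ρ j).asAlgebraHom e = 1 := by
    have hd := IsIrreducible.finrank_ne_zero (ρ j)
    have hsum : ∑ y, c y * (ρ j).character y = Module.finrank k (W j) * Nat.card G := by
      simp only [c, Finset.sum_mul]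
      rw [Finset.sum_comm, Finset.sum_eq_single j]
      · rw [← IsIrreducible.sum_character_mul_character_inv (ρ j), Finset.mul_sum]
        exact Finset.sum_congr rfl fun y _ => by ring
      · intro i _ hij
        rw [← mul_zero (Module.finrank k (W i) : k),
          ← IsIrreducible.sum_character_mul_character_inv_of_isEmpty (ρ j) (ρ i) (hdisj i j hij),
          Finset.mul_sum]
        exact Finset.sum_congr rfl fun y _ => by ring
      · simp
    simp only [e, map_smul, map_sum, asAlgebraHom_single]
    rw [IsIrreducible.sum_smul_of_conj (ρ j) c hc, hsum, smul_smul]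
    field_simp
    simp
  have he : e = 1 := by
    refine eq_one_of_asAlgebraHom_eq_one e fun W' _ _ _ σ hσ => ?_
    obtain ⟨i, ⟨φ⟩⟩ := hcomplete W' σ hσ
    have hφ : σ.asAlgebraHom e = φ.toLinearEquiv.symm.conj ((ρ i).asAlgebraHom e) := by
      simp only [e, map_smul, map_sum, asAlgebraHom_single]
      congr 1
      refine Finset.sum_congr rfl fun y _ => ?_
      congr 1
      ext v
      exact (φ.toLinearEquiv.symm_apply_eq.mpr
        (φ.toIntertwiningMap.isIntertwining _ _ y v).symm).symm
    rw [hφ, hact]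
    exact LinearEquiv.conj_id _
  have hcoeff := congrArg (fun a : k[G] => a.coeff x⁻¹) he
  have hx : (Nat.card G : k)⁻¹ * ∑ i, (Module.finrank k (W i) : k) * (ρ i).character x =
      if x = 1 then 1 else 0 := by
    simpa [e, c, MonoidAlgebra.one_def, Finsupp.single_apply, eq_comm (a := (1 : G))] using hcoeff
  rw [inv_mul_eq_iff_eq_mul₀ hG] at hx
  simpa using hx

end Regular

end Representation


/-- **Mednykh's formula.** Let `G` be a finite group and `g : ℕ`.  Let `(Wᵢ, ρᵢ)` be a
complete family of pairwise non-isomorphic irreducible complex representations of `G`.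
Then the number of `2g`-tuples `(a₁,b₁,…,a_g,b_g) ∈ G^{2g}` with
`∏ᵢ aᵢbᵢaᵢ⁻¹bᵢ⁻¹ = 1` equals `|G|^{2g−1} · Σᵢ (dim Wᵢ)^{2−2g}` (integer powers, so
`|G|⁻¹` appears when `g = 0`).  Equivalently
`#Hom(π₁(Σ_g), G)·|G|^{E−1} = Σ_V (dim V)^E` with `E = 2 − 2g`. -/
theorem mednykh_formula (G : Type) [Group G] [Fintype G] (g : ℕ)
    (ι : Type) [Fintype ι]
    (W : ι → Type) [∀ i, AddCommGroup (W i)] [∀ i, Module ℂ (W i)]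
    [∀ i, FiniteDimensional ℂ (W i)]
    (ρ : ∀ i, Representation ℂ G (W i))
    (hirr : ∀ i, IsSimpleModule (MonoidAlgebra ℂ G) (ρ i).asModule)
    (hdisj : ∀ i j, i ≠ j →
      ¬ ∃ f : W i ≃ₗ[ℂ] W j, ∀ (x : G) (v : W i), f ((ρ i) x v) = (ρ j) x (f v))
    (hcomplete : ∀ (W' : Type) [AddCommGroup W'] [Module ℂ W'] [FiniteDimensional ℂ W'],
      ∀ σ : Representation ℂ G W', IsSimpleModule (MonoidAlgebra ℂ G) σ.asModule →
        ∃ i, ∃ f : W' ≃ₗ[ℂ] W i, ∀ (x : G) (v : W'), f (σ x v) = (ρ i) x (f v)) :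
    (Nat.card {t : Fin g → G × G //
        (List.ofFn fun i : Fin g => (t i).1 * (t i).2 * (t i).1⁻¹ * (t i).2⁻¹).prod = 1} : ℝ)
      = (Fintype.card G : ℝ) ^ (2 * (g : ℤ) - 1) *
        ∑ i, (Module.finrank ℂ (W i) : ℝ) ^ (2 - 2 * (g : ℤ)) := by
  classical
  have hirr' (i : ι) : (ρ i).IsIrreducible :=
    (Representation.irreducible_iff_isSimpleModule_asModule _).mpr (hirr i)
  have hreg (x : G) := Representation.sum_finrank_mul_character ρ
    (fun i j hij => ⟨fun φ => hdisj i j hij ⟨φ.toLinearEquiv,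
      fun x v => φ.toIntertwiningMap.isIntertwining _ _ x v⟩⟩)
    (fun W' _ _ _ σ hσ => by
      obtain ⟨i, f, hf⟩ := hcomplete W' σ
        ((Representation.irreducible_iff_isSimpleModule_asModule _).mp hσ)
      exact ⟨i, ⟨.mk f fun x => LinearMap.ext fun v => hf x v⟩⟩) x
  have hG : (Fintype.card G : ℂ) ≠ 0 := by exact_mod_cast Fintype.card_ne_zero
  have hcount : (Fintype.card G : ℂ) * (Nat.card {t : Fin g → G × G //
      (List.ofFn fun i : Fin g => (t i).1 * (t i).2 * (t i).1⁻¹ * (t i).2⁻¹).prod = 1} : ℂ) =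
      ∑ i, (Module.finrank ℂ (W i) : ℂ) *
        (((Fintype.card G : ℂ) / Module.finrank ℂ (W i)) ^ (2 * g) *
          Module.finrank ℂ (W i)) := by
    rw [← Nat.card_eq_fintype_card (α := G)]
    simp_rw [fun i => (Representation.IsIrreducible.sum_character_prod_commutator (ρ i) g).symm,
      Finset.mul_sum]
    rw [Finset.sum_comm]
    simp_rw [hreg]
    rw [← Finset.sum_filter, Finset.sum_const, nsmul_eq_mul,
      Nat.card_eq_fintype_card (α := G), Nat.card_eq_fintype_card, Fintype.card_subtype, mul_comm]
  rw [← Complex.ofReal_inj]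
  push_cast
  apply mul_left_cancel₀ hG
  rw [hcount, ← mul_assoc, Finset.mul_sum]
  refine Finset.sum_congr rfl fun i _ => ?_
  have hd := Representation.IsIrreducible.finrank_ne_zero (ρ i)
  rw [← zpow_one_add₀ hG, zpow_sub₀ hd, show 1 + (2 * (g : ℤ) - 1) = ((2 * g : ℕ) : ℤ) by
    push_cast; ring, show 2 * (g : ℤ) = ((2 * g : ℕ) : ℤ) by push_cast; rfl, zpow_natCast,
    zpow_natCast, div_pow]
  field_simp
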